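/- Let V ∈ ℝ^{C×D} have no zero entries and pairwise distinct entries in its d-th column, let a ∈ ℝ^C, and let x' ∈ ℝ^D with x'_d ≠ 0. Then the maximum softmax probability converges to a fixed value in the limit: max_{c} softmax(V x_α + a)_c → 1 as α → ∞. -/

import Mathlib

/-- The softmax function on `ℝ^C`. -/
noncomputable def softmax {C : ℕ} (z : Fin C → ℝ) : Fin C → ℝ :=
  fun c => Real.exp (z c) / ∑ c', Real.exp (z c')

/-- The point `x'` scaled by `α` in coordinate `d` (all other coordinates unchanged). -/
def scaled {D : ℕ} (x' : Fin D → ℝ) (d : Fin D) (α : ℝ) : Fin D → ℝ :=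
  Function.update x' d (α * x' d)

open Filter Topology

theorem softmax_eq_inv_sum_exp_sub {C : ℕ} (z : Fin C → ℝ) (m : Fin C) :
    softmax z m = (∑ c, Real.exp (z c - z m))⁻¹ := by
  simp only [softmax, Real.exp_sub, ← Finset.sum_div, inv_div]

theorem softmax_le_one {C : ℕ} (z : Fin C → ℝ) (c : Fin C) : softmax z c ≤ 1 :=
  div_le_one_of_le₀
    (Finset.single_le_sum (f := fun c' => Real.exp (z c')) (fun _ _ => (Real.exp_pos _).le)
      (Finset.mem_univ c))
    (Finset.sum_nonneg fun _ _ => (Real.exp_pos _).le)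

/-- Softmax of logits growing affinely in `α` concentrates on the logit of largest slope. -/
theorem tendsto_softmax_of_slope_lt {C : ℕ} (s b : Fin C → ℝ) (m : Fin C)
    (hm : ∀ c, c ≠ m → s c < s m) :
    Tendsto (fun α : ℝ => softmax (fun c => α * s c + b c) m) atTop (𝓝 1) := by
  simp only [softmax_eq_inv_sum_exp_sub]
  have hterm : ∀ c, Tendsto (fun α : ℝ => Real.exp (α * s c + b c - (α * s m + b m))) atTop
      (𝓝 (if c = m then 1 else 0)) := by
    intro c
    split_ifs with h
    · simp [h]
    · refine Real.tendsto_exp_atBot.comp ?_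
      have hlin : Tendsto (fun α : ℝ => α * (s c - s m) + (b c - b m)) atTop atBot :=
        tendsto_atBot_add_const_right _ _
          (tendsto_id.atTop_mul_const_of_neg (sub_neg.2 (hm c h)))
      exact hlin.congr fun α => by ring
  simpa using (tendsto_finsetSum Finset.univ fun c _ => hterm c).inv₀ (by simp)

theorem mulVec_scaled {C D : ℕ} (V : Matrix (Fin C) (Fin D) ℝ) (x' : Fin D → ℝ) (d : Fin D)
    (α : ℝ) (c : Fin C) :
    V.mulVec (scaled x' d α) c
      = α * (V c d * x' d) + V.mulVec (Function.update x' d 0) c := by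
  have h : scaled x' d α = Pi.single d (α * x' d) + Function.update x' d 0 := by
    ext i
    by_cases hi : i = d
    · subst hi; simp [scaled]
    · simp [scaled, hi]
  rw [h, Matrix.mulVec_add, Pi.add_apply, Matrix.mulVec_single]
  simp [Matrix.col]
  ring

theorem stmt_9 (D C : ℕ) (hC : 1 ≤ C)
    (V : Matrix (Fin C) (Fin D) ℝ) (a : Fin C → ℝ) (d : Fin D)
    (hV : ∀ c d', V c d' ≠ 0)
    (hcol : Function.Injective fun c => V c d)
    (x' : Fin D → ℝ) (hx' : x' d ≠ 0) :
    Filter.Tendsto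
      (fun α : ℝ => ⨆ c : Fin C, softmax (V.mulVec (scaled x' d α) + a) c)
      Filter.atTop (nhds 1) := by
  have : Nonempty (Fin C) := ⟨⟨0, hC⟩⟩
  obtain ⟨m, hm⟩ := Finite.exists_max fun c => V c d * x' d
  have hlt : ∀ c, c ≠ m → V c d * x' d < V m d * x' d := fun c hc =>
    (hm c).lt_of_ne fun h => hc (hcol (mul_right_cancel₀ hx' h))
  have hlogits : ∀ α : ℝ, V.mulVec (scaled x' d α) + a = fun c =>
      α * (V c d * x' d) + (V.mulVec (Function.update x' d 0) c + a c) := fun α => by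
    ext c
    rw [Pi.add_apply, mulVec_scaled, add_assoc]
  simp only [hlogits]
  exact tendsto_of_tendsto_of_tendsto_of_le_of_le
    (tendsto_softmax_of_slope_lt _ _ m hlt) tendsto_const_nhds
    (fun α => le_ciSup (Set.finite_range _).bddAbove m)
    (fun α => ciSup_le fun c => softmax_le_one _ c)
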